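/- Fix η ∈ ℝ with 0 ≤ η ≤ 1 and let B be a beam-splitter coefficient family for η. For I, K, n ∈ ℕ define Γ_n^{(I,K)} := ∑_{i=0}^{I} ∑_{k=0}^{K} (B^{(i,k)}_n − B^{(i,k)}_{n+1}). Then for all n ∈ ℕ and all I ≥ 1, K ≥ 1, Γ_n^{(I,K)} = B^{(I,K)}_n + η · Γ_n^{(I,K−1)} + (1−η) · Γ_n^{(I−1,K)}. -/

import Mathlib

/-- Extension of a coefficient family to integer indices: terms with a negative
index are set to zero (they are "omitted" in the recurrence). -/
noncomputable def bsExt (B : ℕ → ℕ → ℕ → ℝ) : ℤ → ℤ → ℤ → ℝ :=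
  fun i k m => if 0 ≤ i ∧ 0 ≤ k ∧ 0 ≤ m then B i.toNat k.toNat m.toNat else 0

/-- A beam-splitter coefficient family for transmittance `η`:
`B^{(i,k)}_m` are the Fock-basis transition probabilities of a beam splitter,
determined by the initial condition `B^{(0,0)}_0 = 1`, the vanishing condition
`B^{(i,k)}_m = 0` for `m > i + k`, and the recurrence relation (terms with a
negative index being omitted). -/
structure IsBSFamily (η : ℝ) (B : ℕ → ℕ → ℕ → ℝ) : Prop where
  init : B 0 0 0 = 1
  vanish : ∀ i k m : ℕ, i + k < m → B i k m = 0
  recur : ∀ i k m : ℕ, m ≤ i + k → ¬(i = 0 ∧ k = 0 ∧ m = 0) →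
    B i k m =
      η * bsExt B ((i : ℤ) - 1) (k : ℤ) ((m : ℤ) - 1)
        + (1 - η) * bsExt B ((i : ℤ) - 1) (k : ℤ) (m : ℤ)
        + η * bsExt B (i : ℤ) ((k : ℤ) - 1) (m : ℤ)
        + (1 - η) * bsExt B (i : ℤ) ((k : ℤ) - 1) ((m : ℤ) - 1)
        - bsExt B ((i : ℤ) - 1) ((k : ℤ) - 1) ((m : ℤ) - 1)

/-- `Γ_n^{(I,K)} = ∑_{i=0}^{I} ∑_{k=0}^{K} (B^{(i,k)}_n − B^{(i,k)}_{n+1})`. -/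
noncomputable def bsGamma (B : ℕ → ℕ → ℕ → ℝ) (I K n : ℕ) : ℝ :=
  ∑ i ∈ Finset.range (I + 1), ∑ k ∈ Finset.range (K + 1), (B i k n - B i k (n + 1))

lemma bs_r00 {η : ℝ} {B : ℕ → ℕ → ℕ → ℝ} (hB : IsBSFamily η B) (n : ℕ) :
    B 0 0 (n + 1) = 0 := hB.vanish 0 0 (n + 1) (by omega)

lemma bsExt_nat (B : ℕ → ℕ → ℕ → ℝ) (i k m : ℕ) : bsExt B i k m = B i k m := by
  simp [bsExt]

lemma bsExt_neg1 (B : ℕ → ℕ → ℕ → ℝ) (k m : ℤ) : bsExt B (-1) k m = 0 := by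
  simp [bsExt]

lemma bsExt_neg2 (B : ℕ → ℕ → ℕ → ℝ) (i m : ℤ) : bsExt B i (-1) m = 0 := by
  simp [bsExt]

lemma bs_r0 {η : ℝ} {B : ℕ → ℕ → ℕ → ℝ} (hB : IsBSFamily η B) (k n : ℕ) :
    B 0 (k + 1) (n + 1) = η * B 0 k (n + 1) + (1 - η) * B 0 k n := by
  by_cases h : n + 1 ≤ 0 + (k + 1)
  · have := hB.recur 0 (k + 1) (n + 1) h (by omega)
    have e1 : ((k + 1 : ℕ) : ℤ) - 1 = (k : ℕ) := by push_cast; ring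
    have e2 : ((n + 1 : ℕ) : ℤ) - 1 = (n : ℕ) := by push_cast; ring
    have e3 : ((0 : ℕ) : ℤ) - 1 = -1 := by norm_num
    rw [e1, e2, e3] at this
    simp only [bsExt_neg1, bsExt_nat] at this
    linarith
  · rw [hB.vanish _ _ _ (by omega), hB.vanish _ _ _ (by omega), hB.vanish _ _ _ (by omega)]
    ring

lemma bs_r1 {η : ℝ} {B : ℕ → ℕ → ℕ → ℝ} (hB : IsBSFamily η B) (i n : ℕ) :
    B (i + 1) 0 (n + 1) = η * B i 0 n + (1 - η) * B i 0 (n + 1) := by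
  by_cases h : n + 1 ≤ (i + 1) + 0
  · have := hB.recur (i + 1) 0 (n + 1) h (by omega)
    have e1 : ((i + 1 : ℕ) : ℤ) - 1 = (i : ℕ) := by push_cast; ring
    have e2 : ((n + 1 : ℕ) : ℤ) - 1 = (n : ℕ) := by push_cast; ring
    have e3 : ((0 : ℕ) : ℤ) - 1 = -1 := by norm_num
    rw [e1, e2, e3] at this
    simp only [bsExt_neg2, bsExt_nat] at this
    linarith
  · rw [hB.vanish _ _ _ (by omega), hB.vanish _ _ _ (by omega), hB.vanish _ _ _ (by omega)]
    ring

lemma bs_r {η : ℝ} {B : ℕ → ℕ → ℕ → ℝ} (hB : IsBSFamily η B) (i k n : ℕ) :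
    B (i + 1) (k + 1) (n + 1) = η * B i (k + 1) n + (1 - η) * B i (k + 1) (n + 1)
      + η * B (i + 1) k (n + 1) + (1 - η) * B (i + 1) k n - B i k n := by
  by_cases h : n + 1 ≤ (i + 1) + (k + 1)
  · have := hB.recur (i + 1) (k + 1) (n + 1) h (by omega)
    have e1 : ((i + 1 : ℕ) : ℤ) - 1 = (i : ℕ) := by push_cast; ring
    have e2 : ((n + 1 : ℕ) : ℤ) - 1 = (n : ℕ) := by push_cast; ring
    have e3 : ((k + 1 : ℕ) : ℤ) - 1 = (k : ℕ) := by push_cast; ring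
    rw [e1, e2, e3] at this
    simp only [bsExt_nat] at this
    linarith
  · rw [hB.vanish (i+1) (k+1) _ (by omega), hB.vanish i (k+1) n (by omega),
      hB.vanish i (k+1) (n+1) (by omega), hB.vanish (i+1) k n (by omega),
      hB.vanish (i+1) k (n+1) (by omega), hB.vanish i k n (by omega)]
    ring

lemma bs_row0 {η : ℝ} {B : ℕ → ℕ → ℕ → ℝ} (hB : IsBSFamily η B) (n K : ℕ) :
    ∑ k ∈ Finset.range (K + 1), (B 0 k n - B 0 k (n + 1)) =
      B 0 K n + η * ∑ k ∈ Finset.range K, (B 0 k n - B 0 k (n + 1)) := by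
  induction K with
  | zero => simp [bs_r00 hB n]
  | succ K ih =>
    have h := bs_r0 hB K n
    simp only [Finset.sum_range_succ] at ih ⊢
    linear_combination ih - h

lemma bs_row {η : ℝ} {B : ℕ → ℕ → ℕ → ℝ} (hB : IsBSFamily η B) (n i K : ℕ) :
    ∑ k ∈ Finset.range (K + 1), (B (i + 1) k n - B (i + 1) k (n + 1)) =
      B (i + 1) K n - B i K n
      + η * ∑ k ∈ Finset.range K, (B (i + 1) k n - B (i + 1) k (n + 1))
      + (1 - η) * ∑ k ∈ Finset.range (K + 1), (B i k n - B i k (n + 1)) := by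
  induction K with
  | zero => simp [bs_r1 hB i n]; ring
  | succ K ih =>
    have h := bs_r hB i K n
    simp only [Finset.sum_range_succ] at ih ⊢
    linear_combination ih - h

/-- For a beam-splitter coefficient family `B` for `η ∈ [0,1]`, for all
`n ∈ ℕ` and `I, K ≥ 1`:
`Γ_n^{(I,K)} = B^{(I,K)}_n + η Γ_n^{(I,K−1)} + (1−η) Γ_n^{(I−1,K)}`. -/
theorem bsGamma_recurrence
    (η : ℝ) (hη0 : 0 ≤ η) (hη1 : η ≤ 1)
    (B : ℕ → ℕ → ℕ → ℝ) (hB : IsBSFamily η B) :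
    ∀ n I K : ℕ, 1 ≤ I → 1 ≤ K →
      bsGamma B I K n =
        B I K n + η * bsGamma B I (K - 1) n + (1 - η) * bsGamma B (I - 1) K n := by
  intro n I K hI hK
  obtain ⟨I, rfl⟩ : ∃ J, I = J + 1 := ⟨I - 1, by omega⟩
  obtain ⟨K, rfl⟩ : ∃ J, K = J + 1 := ⟨K - 1, by omega⟩
  clear hI hK
  simp only [bsGamma, Nat.add_sub_cancel]
  induction I with
  | zero =>
    have h0 := bs_row0 hB n (K + 1)
    have h1 := bs_row hB n 0 (K + 1)
    simp only [Finset.sum_range_succ _ (0 + 1), Finset.sum_range_one, zero_add] at *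
    linarith
  | succ I ih =>
    have h1 := bs_row hB n (I + 1) (K + 1)
    simp only [Finset.sum_range_succ, Finset.sum_add_distrib] at ih h1 ⊢
    linear_combination ih + h1
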